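/- arXiv:0808.0602 — 6 statements merged into one kernel-verified Lean document; each statement's English description precedes it below -/
import Mathlib

section
/- Let (X,T) be a minimal Cantor system, I ⊆ X a nonempty clopen set, r_1 < … < r_l the distinct values taken by N_I^{(1)} on I, and τ(i) = {x ∈ I : N_I^{(1)}(x) = r_i} for 1 ≤ i ≤ l. Then the family of sets {T^j(τ(i)) : 1 ≤ i ≤ l, 0 ≤ j ≤ r_i − 1} is a partition of X: the sets T^j(τ(i)) for distinct pairs (i,j) are pairwise disjoint, and their union is all of X. -/
open Function

/-- The entrance time `N_I^{(1)}(x) = inf {n ≥ 1 : T^n x ∈ I}` (with the convention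
`sInf ∅ = 0` in `ℕ`; by minimality the infimum is over a nonempty set). -/
noncomputable def entranceTime {X : Type*} (T : X → X) (I : Set X) (x : X) : ℕ :=
  sInf {n : ℕ | 1 ≤ n ∧ T^[n] x ∈ I}

theorem Homeomorph.continuous_toEquiv_zpow {X : Type*} [TopologicalSpace X] (T : X ≃ₜ X) (n : ℤ) :
    Continuous (T.toEquiv ^ n : Equiv.Perm X) := by
  cases n with
  | ofNat k =>
    rw [Int.ofNat_eq_natCast, zpow_natCast, ← Equiv.Perm.iterate_eq_pow]
    exact T.continuous.iterate k
  | negSucc k =>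
    rw [zpow_negSucc, ← inv_pow, ← Equiv.Perm.iterate_eq_pow]
    exact T.symm.continuous.iterate (k + 1)

/-- In a compact minimal system, visits to a nonempty open set occur with bounded gaps. -/
theorem exists_bound_visit_of_dense_orbits {X : Type*} [TopologicalSpace X] [CompactSpace X]
    (T : X ≃ₜ X) (hmin : ∀ x : X, Dense (Set.range fun n : ℤ => (T.toEquiv ^ n) x))
    {I : Set X} (hI : IsOpen I) (hIne : I.Nonempty) :
    ∃ N : ℕ, ∀ x : X, ∃ n : ℤ, |n| ≤ N ∧ (T.toEquiv ^ n) x ∈ I := by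
  obtain ⟨s, hs⟩ := isCompact_univ.elim_finite_subcover
    (fun n : ℤ => (fun x => (T.toEquiv ^ n) x) ⁻¹' I)
    (fun n => hI.preimage (T.continuous_toEquiv_zpow n)) (by
      intro x _
      obtain ⟨_, hy, n, rfl⟩ := (hmin x).inter_open_nonempty I hI hIne
      exact Set.mem_iUnion.2 ⟨n, hy⟩)
  refine ⟨s.sup Int.natAbs, fun x => ?_⟩
  obtain ⟨n, hn, hx⟩ := Set.mem_iUnion₂.1 (hs (Set.mem_univ x))
  refine ⟨n, ?_, hx⟩
  have := Finset.le_sup (f := Int.natAbs) hn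
  rw [Int.abs_eq_natAbs]
  exact_mod_cast this

theorem exists_pos_iterate_mem_of_dense_orbits {X : Type*} [TopologicalSpace X] [CompactSpace X]
    (T : X ≃ₜ X) (hmin : ∀ x : X, Dense (Set.range fun n : ℤ => (T.toEquiv ^ n) x))
    {I : Set X} (hI : IsOpen I) (hIne : I.Nonempty) (x : X) :
    ∃ n : ℕ, 1 ≤ n ∧ T^[n] x ∈ I := by
  obtain ⟨N, hN⟩ := exists_bound_visit_of_dense_orbits T hmin hI hIne
  obtain ⟨n, hn, hx⟩ := hN ((T.toEquiv ^ ((N : ℤ) + 1)) x)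
  rw [← Equiv.Perm.mul_apply, ← zpow_add] at hx
  have h := abs_le.1 hn
  obtain ⟨k, hk⟩ := Int.eq_ofNat_of_zero_le (show 0 ≤ n + (N + 1) by lia)
  rw [hk, zpow_natCast, ← Equiv.Perm.iterate_eq_pow] at hx
  exact ⟨k, by lia, hx⟩

theorem exists_iterate_eq_of_dense_orbits {X : Type*} [TopologicalSpace X] [CompactSpace X]
    (T : X ≃ₜ X) (hmin : ∀ x : X, Dense (Set.range fun n : ℤ => (T.toEquiv ^ n) x))
    {I : Set X} (hI : IsOpen I) (hIne : I.Nonempty) (x : X) :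
    ∃ k : ℕ, ∃ y ∈ I, T^[k] y = x := by
  obtain ⟨N, hN⟩ := exists_bound_visit_of_dense_orbits T hmin hI hIne
  obtain ⟨n, hn, hx⟩ := hN ((T.toEquiv ^ (-(N : ℤ))) x)
  rw [← Equiv.Perm.mul_apply, ← zpow_add] at hx
  have h := abs_le.1 hn
  obtain ⟨k, hk⟩ := Int.eq_ofNat_of_zero_le (show 0 ≤ -(n + -N) by lia)
  refine ⟨k, _, hx, ?_⟩
  change (T.toEquiv : X → X)^[k] _ = x
  rw [Equiv.Perm.iterate_eq_pow, ← zpow_natCast, ← hk, ← Equiv.Perm.mul_apply, ← zpow_add,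
    neg_add_cancel, zpow_zero, Equiv.Perm.one_apply]

theorem entranceTime_le {X : Type*} {T : X → X} {I : Set X} {x : X} {n : ℕ} (hn : 1 ≤ n)
    (hx : T^[n] x ∈ I) : entranceTime T I x ≤ n :=
  Nat.sInf_le ⟨hn, hx⟩

/-- Two points of `I` whose orbits meet before their entrance times coincide, and so do the
meeting times. -/
theorem eq_of_iterate_eq_of_lt_entranceTime {X : Type*} {T : X → X} (hT : Injective T) {I : Set X}
    {y y' : X} (hy : y ∈ I) (hy' : y' ∈ I) {j j' : ℕ} (hj : j < entranceTime T I y)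
    (hj' : j' < entranceTime T I y') (h : T^[j] y = T^[j'] y') : j = j' ∧ y = y' := by
  wlog hle : j ≤ j' generalizing y y' j j'
  · obtain ⟨h₁, h₂⟩ := this hy' hy hj' hj h.symm (by lia)
    exact ⟨h₁.symm, h₂.symm⟩
  obtain ⟨d, rfl⟩ := Nat.exists_eq_add_of_le hle
  rw [iterate_add_apply] at h
  have hyd := hT.iterate j h
  rcases Nat.eq_zero_or_pos d with rfl | hd
  · exact ⟨rfl, hyd⟩
  · have := entranceTime_le hd (hyd ▸ hy)
    lia

/-- For a minimal Cantor system `(X,T)`, a nonempty clopen `I`, and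
`r 1 < … < r l` the distinct values of the entrance time `N_I^{(1)}` on `I` with level
sets `τ i = {x ∈ I : N_I^{(1)} x = r i}`, the family `{T^j (τ i) : i, 0 ≤ j < r i}` is a
partition of `X`: the pieces indexed by distinct pairs `(i,j)` are pairwise disjoint
and their union is all of `X`. -/
theorem stmt_2 {X : Type*} [TopologicalSpace X] [CompactSpace X] [Nonempty X]
    [TopologicalSpace.MetrizableSpace X] [TotallyDisconnectedSpace X] [PerfectSpace X]
    (T : X ≃ₜ X)
    (hmin : ∀ x : X, Dense (Set.range fun n : ℤ => (T.toEquiv ^ n) x))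
    (I : Set X) (hI : IsClopen I) (hIne : I.Nonempty)
    (l : ℕ) (r : Fin l → ℕ) (hr : StrictMono r)
    (hval : ∀ x ∈ I, ∃ i : Fin l, entranceTime (⇑T) I x = r i)
    (hall : ∀ i : Fin l, ∃ x ∈ I, entranceTime (⇑T) I x = r i)
    (τ : Fin l → Set X)
    (hτ : ∀ i : Fin l, τ i = {x ∈ I | entranceTime (⇑T) I x = r i}) :
    (∀ i i' : Fin l, ∀ j j' : ℕ, j < r i → j' < r i' → (i, j) ≠ (i', j') →
      Disjoint ((⇑T)^[j] '' τ i) ((⇑T)^[j'] '' τ i')) ∧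
    (⋃ i : Fin l, ⋃ j ∈ Finset.range (r i), (⇑T)^[j] '' τ i) = Set.univ := by
  refine ⟨?_, ?_⟩
  · intro i i' j j' hj hj' hne
    rw [Set.disjoint_left]
    rintro _ ⟨y, hy, rfl⟩ ⟨y', hy', h⟩
    rw [hτ] at hy hy'
    obtain ⟨rfl, rfl⟩ := eq_of_iterate_eq_of_lt_entranceTime T.injective hy.1 hy'.1
      (hy.2 ▸ hj) (hy'.2 ▸ hj') h.symm
    exact hne (Prod.ext (hr.injective (hy.2.symm.trans hy'.2)) rfl)
  · refine Set.eq_univ_of_forall fun x => ?_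
    classical
    have hback := exists_iterate_eq_of_dense_orbits T hmin hI.isOpen hIne x
    obtain ⟨y, hy, hyx⟩ := Nat.find_spec hback
    obtain ⟨i, hi⟩ := hval y hy
    have hmem : 1 ≤ entranceTime T I y ∧ T^[entranceTime T I y] y ∈ I :=
      Nat.sInf_mem (exists_pos_iterate_mem_of_dense_orbits T hmin hI.isOpen hIne y)
    rw [hi] at hmem
    simp only [Set.mem_iUnion, Finset.mem_range]
    refine ⟨i, Nat.find hback, ?_, y, by rw [hτ]; exact ⟨hy, hi⟩, hyx⟩
    by_contra! hle
    refine Nat.find_min hback (Nat.sub_lt_self hmem.1 hle) ⟨_, hmem.2, ?_⟩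
    rw [← iterate_add_apply, Nat.sub_add_cancel hle, hyx]
end

section
/- Let p be a prime, T : ℤ_p → ℤ_p the odometer T(x) = x + 1, and μ the Haar probability measure on the additive group ℤ_p. For n ≥ 1 and c ∈ ℤ_p set I_n = c + p^n ℤ_p. Then μ(I_n) = p^{−n}; for every integer m with 0 ≤ m ≤ p^n, μ{x ∈ ℤ_p : N_{I_n}^{(1)}(x) ≤ m} = m/p^n; and for every real t ≥ 0, μ{x ∈ ℤ_p : μ(I_n) · N_{I_n}^{(1)}(x) ≤ t} = min(⌊t·p^n⌋, p^n)/p^n. Consequently, as n → ∞ the distribution functions F_n(t) = μ{x : μ(I_n) · N_{I_n}^{(1)}(x) ≤ t} converge, uniformly in t ≥ 0, to the uniform law on [0,1], i.e. to t ↦ min(t,1). -/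
open Function MeasureTheory

/-- The fibre of reduction modulo `p ^ n` over the class of `c` is the cylinder `c + p ^ n ℤ_p`. -/
theorem toZModPow_eq_iff_exists {p : ℕ} [Fact p.Prime] (n : ℕ) (c y : ℤ_[p]) :
    PadicInt.toZModPow n y = PadicInt.toZModPow n c ↔
      ∃ z : ℤ_[p], y = c + (p : ℤ_[p]) ^ n * z := by
  rw [← sub_eq_zero, ← map_sub, ← RingHom.mem_ker, PadicInt.ker_toZModPow,
    Ideal.mem_span_singleton]
  exact exists_congr fun z => sub_eq_iff_eq_add'

theorem measurableSet_toZModPow_fiber {p : ℕ} [Fact p.Prime]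
    [MeasurableSpace ℤ_[p]] [BorelSpace ℤ_[p]] (n : ℕ) (b : ZMod (p ^ n)) :
    MeasurableSet (PadicInt.toZModPow (p := p) n ⁻¹' {b}) := by
  obtain ⟨c, rfl⟩ := ZMod.ringHom_surjective (PadicInt.toZModPow (p := p) n) b
  have h : PadicInt.toZModPow (p := p) n ⁻¹' {PadicInt.toZModPow n c} =
      Metric.closedBall c ((p : ℝ) ^ (-n : ℤ)) := by
    ext y
    rw [Set.mem_preimage, Set.mem_singleton_iff, Metric.mem_closedBall, dist_eq_norm,
      PadicInt.norm_le_pow_iff_mem_span_pow, ← PadicInt.ker_toZModPow, RingHom.mem_ker, map_sub,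
      sub_eq_zero]
  rw [h]
  exact Metric.isClosed_closedBall.measurableSet

/-- A translation-invariant measure gives the same mass to all residue classes. -/
theorem measure_toZModPow_fiber_eq {p : ℕ} [Fact p.Prime]
    [MeasurableSpace ℤ_[p]] [BorelSpace ℤ_[p]] (μ : Measure ℤ_[p])
    (hinv : ∀ (a : ℤ_[p]) (A : Set ℤ_[p]), MeasurableSet A → μ ((fun x => a + x) ⁻¹' A) = μ A)
    (n : ℕ) (b : ZMod (p ^ n)) :
    μ (PadicInt.toZModPow (p := p) n ⁻¹' {b}) = μ (PadicInt.toZModPow (p := p) n ⁻¹' {0}) := by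
  obtain ⟨c, rfl⟩ := ZMod.ringHom_surjective (PadicInt.toZModPow (p := p) n) b
  rw [← hinv c _ (measurableSet_toZModPow_fiber n (PadicInt.toZModPow n c))]
  congr 1
  ext y
  simp

theorem measure_toZModPow_preimage_eq_card_mul {p : ℕ} [Fact p.Prime]
    [MeasurableSpace ℤ_[p]] [BorelSpace ℤ_[p]] (μ : Measure ℤ_[p])
    (hinv : ∀ (a : ℤ_[p]) (A : Set ℤ_[p]), MeasurableSet A → μ ((fun x => a + x) ⁻¹' A) = μ A)
    (n : ℕ) (S : Finset (ZMod (p ^ n))) :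
    μ (PadicInt.toZModPow (p := p) n ⁻¹' S) =
      S.card * μ (PadicInt.toZModPow (p := p) n ⁻¹' {0}) := by
  rw [← sum_measure_preimage_singleton S fun b _ => measurableSet_toZModPow_fiber n b,
    Finset.sum_congr rfl fun b _ => measure_toZModPow_fiber_eq μ hinv n b, Finset.sum_const,
    nsmul_eq_mul]

theorem measure_toZModPow_preimage {p : ℕ} [Fact p.Prime]
    [MeasurableSpace ℤ_[p]] [BorelSpace ℤ_[p]] (μ : Measure ℤ_[p]) [IsProbabilityMeasure μ]
    (hinv : ∀ (a : ℤ_[p]) (A : Set ℤ_[p]), MeasurableSet A → μ ((fun x => a + x) ⁻¹' A) = μ A)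
    (n : ℕ) (S : Finset (ZMod (p ^ n))) :
    μ (PadicInt.toZModPow (p := p) n ⁻¹' S) = (S.card : ENNReal) / (p : ENNReal) ^ n := by
  have h := measure_toZModPow_preimage_eq_card_mul μ hinv n Finset.univ
  rw [Finset.coe_univ, Set.preimage_univ, measure_univ, Finset.card_univ, ZMod.card, Nat.cast_pow,
    mul_comm] at h
  rw [measure_toZModPow_preimage_eq_card_mul μ hinv, ENNReal.eq_inv_of_mul_eq_one_left h.symm,
    div_eq_mul_inv]

/-- A point enters a residue class modulo `p ^ n` under `x ↦ x + 1` within `m` steps exactly when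
it is congruent to one of the `m` predecessors of that class. -/
theorem entranceTime_toZModPow_fiber_le_iff {p : ℕ} [Fact p.Prime] (n m : ℕ) (c x : ℤ_[p]) :
    entranceTime (fun x => x + 1) (PadicInt.toZModPow n ⁻¹' {PadicInt.toZModPow n c}) x ≤ m ↔
      ∃ k : ℕ, 1 ≤ k ∧ k ≤ m ∧
        PadicInt.toZModPow n c - (k : ZMod (p ^ n)) = PadicInt.toZModPow n x := by
  have hmem (k : ℕ) : (fun x : ℤ_[p] => x + 1)^[k] x ∈
        PadicInt.toZModPow n ⁻¹' {PadicInt.toZModPow n c} ↔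
      PadicInt.toZModPow n c - (k : ZMod (p ^ n)) = PadicInt.toZModPow n x := by
    rw [add_right_iterate_apply, nsmul_one, Set.mem_preimage, Set.mem_singleton_iff, map_add,
      map_natCast, sub_eq_iff_eq_add, eq_comm]
  simp only [entranceTime, hmem]
  constructor
  · intro h
    have hne : {k : ℕ | 1 ≤ k ∧
        PadicInt.toZModPow n c - (k : ZMod (p ^ n)) = PadicInt.toZModPow n x}.Nonempty := by
      refine ⟨(PadicInt.toZModPow n c - PadicInt.toZModPow n x).val + p ^ n,
        le_add_of_nonneg_of_le (Nat.zero_le _) (Nat.pos_of_neZero _), ?_⟩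
      rw [Nat.cast_add, ZMod.natCast_self, ZMod.natCast_zmod_val]
      ring
    have hs := Nat.sInf_mem hne
    exact ⟨_, hs.1, h, hs.2⟩
  · rintro ⟨k, hk, hkm, h⟩
    exact le_trans (Nat.sInf_le ⟨hk, h⟩) hkm

/-- The entrance time into a residue class modulo `p ^ n` is at most `p ^ n`. -/
theorem entranceTime_toZModPow_fiber_le {p : ℕ} [Fact p.Prime] (n : ℕ) (c x : ℤ_[p]) :
    entranceTime (fun x => x + 1) (PadicInt.toZModPow n ⁻¹' {PadicInt.toZModPow n c}) x ≤
      p ^ n := by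
  rw [entranceTime_toZModPow_fiber_le_iff]
  rcases Nat.eq_zero_or_pos (PadicInt.toZModPow n c - PadicInt.toZModPow n x).val with h | h
  · rw [ZMod.val_eq_zero, sub_eq_zero] at h
    exact ⟨p ^ n, Nat.pos_of_neZero _, le_rfl, by rw [ZMod.natCast_self, sub_zero, h]⟩
  · exact ⟨_, h, (ZMod.val_lt _).le, by rw [ZMod.natCast_zmod_val, sub_sub_cancel]⟩

theorem measure_entranceTime_toZModPow_fiber_le {p : ℕ} [Fact p.Prime]
    [MeasurableSpace ℤ_[p]] [BorelSpace ℤ_[p]] (μ : Measure ℤ_[p]) [IsProbabilityMeasure μ]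
    (hinv : ∀ (a : ℤ_[p]) (A : Set ℤ_[p]), MeasurableSet A → μ ((fun x => a + x) ⁻¹' A) = μ A)
    (n : ℕ) (c : ℤ_[p]) (m : ℕ) :
    μ {x | entranceTime (fun x => x + 1)
        (PadicInt.toZModPow n ⁻¹' {PadicInt.toZModPow n c}) x ≤ m} =
      ((min m (p ^ n) : ℕ) : ENNReal) / (p : ENNReal) ^ n := by
  have hinj : Set.InjOn (fun k : ℕ => PadicInt.toZModPow n c - (k : ZMod (p ^ n)))
      (Finset.Icc 1 (min m (p ^ n))) := by
    intro a ha b hb hab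
    simp only [Finset.coe_Icc, Set.mem_Icc] at ha hb
    have hmod := (ZMod.natCast_eq_natCast_iff a b (p ^ n)).1 (sub_right_injective hab)
    refine hmod.eq_of_abs_lt ?_
    rw [abs_lt]
    have := ha.2.trans (min_le_right _ _)
    have := hb.2.trans (min_le_right _ _)
    lia
  have hset : {x | entranceTime (fun x => x + 1)
        (PadicInt.toZModPow n ⁻¹' {PadicInt.toZModPow n c}) x ≤ m} =
      PadicInt.toZModPow n ⁻¹' ((Finset.Icc 1 (min m (p ^ n))).image
        fun k : ℕ => PadicInt.toZModPow n c - (k : ZMod (p ^ n)) : Finset (ZMod (p ^ n))) := by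
    ext x
    rw [Set.mem_ofPred_eq,
      ← and_iff_left (a := _ ≤ m) (entranceTime_toZModPow_fiber_le n c x), ← le_min_iff,
      entranceTime_toZModPow_fiber_le_iff]
    simp only [Set.mem_preimage, Finset.mem_coe, Finset.mem_image, Finset.mem_Icc, and_assoc]
  rw [hset, measure_toZModPow_preimage μ hinv, Finset.card_image_of_injOn hinj, Nat.card_Icc,
    Nat.add_sub_cancel]

/-- Rounding `t` down to a multiple of `1 / q` moves `min t 1` by at most `1 / q`. -/
theorem abs_min_floor_div_sub_min_le {q : ℕ} (hq : 0 < q) {t : ℝ} (ht : 0 ≤ t) :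
    |((min ⌊t * q⌋₊ q : ℕ) : ℝ) / q - min t 1| ≤ 1 / q := by
  have hq' : (0 : ℝ) < q := Nat.cast_pos.2 hq
  have hmin : min t 1 = min (t * q) q / q := by
    rw [← min_div_div_right hq'.le, mul_div_cancel_right₀ _ hq'.ne', div_self hq'.ne']
  rw [hmin, ← sub_div, abs_div, abs_of_pos hq', Nat.cast_min]
  gcongr
  have h₁ := Nat.floor_le (mul_nonneg ht hq'.le)
  have h₂ := Nat.lt_floor_add_one (t * q)
  refine (abs_min_sub_min_le_max _ _ _ _).trans (max_le ?_ (by simp))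
  rw [abs_le]
  constructor <;> linarith

/-- For the odometer `T(x) = x + 1` on `ℤ_p` with Haar probability measure
`μ` (the translation-invariant Borel probability measure) and cylinders
`I_n = c + pⁿ ℤ_p` (`n ≥ 1`): `μ(I_n) = p⁻ⁿ`; for `0 ≤ m ≤ pⁿ`,
`μ {x : N_{I_n}^{(1)} x ≤ m} = m/pⁿ`; for `t ≥ 0`,
`μ {x : μ(I_n)·N_{I_n}^{(1)} x ≤ t} = min(⌊t·pⁿ⌋, pⁿ)/pⁿ`; and the distribution
functions `F_n(t) = μ {x : μ(I_n)·N_{I_n}^{(1)} x ≤ t}` converge uniformly in `t ≥ 0`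
to the uniform law `t ↦ min(t,1)` as `n → ∞`. -/
theorem stmt_9 (p : ℕ) [Fact p.Prime]
    [MeasurableSpace ℤ_[p]] [BorelSpace ℤ_[p]]
    (μ : Measure ℤ_[p]) [IsProbabilityMeasure μ]
    (hinv : ∀ (a : ℤ_[p]) (A : Set ℤ_[p]), MeasurableSet A → μ ((fun x => a + x) ⁻¹' A) = μ A)
    (T : ℤ_[p] → ℤ_[p]) (hT : T = fun x => x + 1) (c : ℤ_[p])
    (I : ℕ → Set ℤ_[p])
    (hI : ∀ n : ℕ, I n = {y : ℤ_[p] | ∃ z : ℤ_[p], y = c + (p : ℤ_[p]) ^ n * z}) :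
    (∀ n : ℕ, 1 ≤ n → μ (I n) = ((p : ENNReal) ^ n)⁻¹) ∧
    (∀ n : ℕ, 1 ≤ n → ∀ m : ℕ, m ≤ p ^ n →
      μ {x : ℤ_[p] | entranceTime T (I n) x ≤ m} = (m : ENNReal) / ((p : ENNReal) ^ n)) ∧
    (∀ n : ℕ, 1 ≤ n → ∀ t : ℝ, 0 ≤ t →
      μ {x : ℤ_[p] | (μ (I n)).toReal * (entranceTime T (I n) x : ℝ) ≤ t} =
        ((min (Nat.floor (t * (p : ℝ) ^ n)) (p ^ n) : ℕ) : ENNReal) / ((p : ENNReal) ^ n)) ∧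
    (∀ ε : ℝ, 0 < ε → ∃ N₀ : ℕ, ∀ n : ℕ, N₀ ≤ n → ∀ t : ℝ, 0 ≤ t →
      |(μ {x : ℤ_[p] | (μ (I n)).toReal * (entranceTime T (I n) x : ℝ) ≤ t}).toReal -
        min t 1| < ε) := by
  have hI' (n : ℕ) : I n = PadicInt.toZModPow n ⁻¹' {PadicInt.toZModPow n c} := by
    rw [hI]
    exact Set.ext fun y => (toZModPow_eq_iff_exists n c y).symm
  have hμI (n : ℕ) : μ (I n) = ((p : ENNReal) ^ n)⁻¹ := by
    simpa [hI'] using measure_toZModPow_preimage μ hinv n {PadicInt.toZModPow n c}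
  have hN (n m : ℕ) : μ {x | entranceTime T (I n) x ≤ m} =
      ((min m (p ^ n) : ℕ) : ENNReal) / (p : ENNReal) ^ n := by
    rw [hT, hI']
    exact measure_entranceTime_toZModPow_fiber_le μ hinv n c m
  have hp : 0 < p := (Fact.out : p.Prime).pos
  have hF (n : ℕ) (t : ℝ) (ht : 0 ≤ t) :
      μ {x : ℤ_[p] | (μ (I n)).toReal * (entranceTime T (I n) x : ℝ) ≤ t} =
        ((min (Nat.floor (t * (p : ℝ) ^ n)) (p ^ n) : ℕ) : ENNReal) / ((p : ENNReal) ^ n) := by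
    rw [← hN]
    have hpn : (0 : ℝ) < (p : ℝ) ^ n := by positivity
    congr 1
    ext x
    rw [Set.mem_ofPred_eq, Set.mem_ofPred_eq, Nat.le_floor_iff (by positivity), hμI,
      ENNReal.toReal_inv, ENNReal.toReal_pow, ENNReal.toReal_natCast, inv_mul_le_iff₀ hpn,
      mul_comm t]
  refine ⟨fun n _ => hμI n, fun n _ m hm => by rw [hN, min_eq_left hm], fun n _ => hF n, ?_⟩
  intro ε hε
  have hp1 : (1 : ℝ) < p := Nat.one_lt_cast.2 (Fact.out : p.Prime).one_lt
  obtain ⟨N₀, hN₀⟩ := exists_pow_lt_of_lt_one hε (inv_lt_one_of_one_lt₀ hp1)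
  refine ⟨N₀, fun n hn t ht => ?_⟩
  rw [hF n t ht, ENNReal.toReal_div, ENNReal.toReal_natCast, ENNReal.toReal_pow,
    ENNReal.toReal_natCast]
  have h := abs_min_floor_div_sub_min_le (pow_pos hp n) ht
  rw [Nat.cast_pow] at h
  refine h.trans_lt (lt_of_le_of_lt ?_ hN₀)
  rw [one_div, ← inv_pow]
  exact pow_le_pow_of_le_one (by positivity) (inv_le_one_of_one_le₀ hp1.le) hn
end

section
/- Let p be a prime, n ≥ 1, T : ℤ_p → ℤ_p the odometer T(x) = x + 1, μ the Haar probability measure on ℤ_p, c ∈ ℤ_p, and I = c + p^n ℤ_p. Then for every x ∈ ℤ_p and every k ≥ 2, N_I^{(k)}(x) − N_I^{(k−1)}(x) = p^n. Consequently, for every real t, μ{x : μ(I)·(N_I^{(k)}(x) − N_I^{(k−1)}(x)) ≤ t} equals 0 if t < 1 and equals 1 if t ≥ 1; i.e. the limit law of the k-th return times is the Dirac distribution concentrated at 1. -/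
open Function MeasureTheory

/-- The `k`-th entrance time to `I`: `N^{(0)} = 0`,
`N^{(k+1)}(x) = inf {n > N^{(k)}(x) : T^n x ∈ I}` (so `N^{(1)}(x) = inf {n ≥ 1 : T^n x ∈ I}`),
with the convention `sInf ∅ = 0` in `ℕ`. -/
noncomputable def kthEntranceTime {X : Type*} (T : X → X) (I : Set X) : ℕ → X → ℕ
  | 0, _ => 0
  | (k+1), x => sInf {n : ℕ | kthEntranceTime T I k x < n ∧ T^[n] x ∈ I}

theorem kthEntranceTime_succ_cast {X : Type*} {T : X → X} {I : Set X} {x : X} {q : ℕ} [NeZero q]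
    {a : ZMod q} (h : ∀ m : ℕ, T^[m] x ∈ I ↔ (m : ZMod q) = a) (k : ℕ) :
    (kthEntranceTime T I (k + 1) x : ZMod q) = a := by
  have hne : {m : ℕ | kthEntranceTime T I k x < m ∧ T^[m] x ∈ I}.Nonempty := by
    refine ⟨a.val + q * (kthEntranceTime T I k x + 1), ?_, ?_⟩
    · have := Nat.le_mul_of_pos_left (kthEntranceTime T I k x + 1) (NeZero.pos q)
      omega
    · simp [h]
  exact (h _).1 (Nat.sInf_mem hne).2

theorem kthEntranceTime_succ_succ {X : Type*} {T : X → X} {I : Set X} {x : X} {q : ℕ} [NeZero q]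
    {a : ZMod q} (h : ∀ m : ℕ, T^[m] x ∈ I ↔ (m : ZMod q) = a) (k : ℕ) :
    kthEntranceTime T I (k + 2) x = kthEntranceTime T I (k + 1) x + q := by
  have ha := kthEntranceTime_succ_cast h k
  refine IsLeast.csInf_eq ⟨⟨Nat.lt_add_of_pos_right (NeZero.pos q), by simp [h, ha]⟩, ?_⟩
  rintro m ⟨hlt, hm⟩
  have hmod : kthEntranceTime T I (k + 1) x ≡ m [MOD q] :=
    (ZMod.natCast_eq_natCast_iff _ _ _).1 (ha.trans ((h m).1 hm).symm)
  have := Nat.le_of_dvd (Nat.sub_pos_of_lt hlt) ((Nat.modEq_iff_dvd' hlt.le).1 hmod)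
  omega

theorem PadicInt.coset_eq_preimage_toZModPow (p : ℕ) [Fact p.Prime] (n : ℕ) (c : ℤ_[p]) :
    {y : ℤ_[p] | ∃ z : ℤ_[p], y = c + (p : ℤ_[p]) ^ n * z} =
      PadicInt.toZModPow n ⁻¹' {PadicInt.toZModPow n c} := by
  ext y
  rw [Set.mem_preimage, Set.mem_singleton_iff, ← sub_eq_zero, ← map_sub, ← RingHom.mem_ker,
    PadicInt.ker_toZModPow, Ideal.mem_span_singleton]
  exact exists_congr fun z => sub_eq_iff_eq_add'.symm

theorem PadicInt.measurableSet_coset (p : ℕ) [Fact p.Prime] (n : ℕ)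
    [MeasurableSpace ℤ_[p]] [BorelSpace ℤ_[p]] (c : ℤ_[p]) :
    MeasurableSet {y : ℤ_[p] | ∃ z : ℤ_[p], y = c + (p : ℤ_[p]) ^ n * z} := by
  have hrange : {y : ℤ_[p] | ∃ z : ℤ_[p], y = c + (p : ℤ_[p]) ^ n * z} =
      Set.range fun z : ℤ_[p] => c + (p : ℤ_[p]) ^ n * z := by
    ext y
    simp [eq_comm]
  rw [hrange]
  exact (isCompact_range (by fun_prop)).measurableSet

theorem PadicInt.measure_coset (p : ℕ) [Fact p.Prime] (n : ℕ)
    [MeasurableSpace ℤ_[p]] [BorelSpace ℤ_[p]] (μ : Measure ℤ_[p]) [IsProbabilityMeasure μ]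
    (hinv : ∀ (a : ℤ_[p]) (A : Set ℤ_[p]), MeasurableSet A → μ ((fun x => a + x) ⁻¹' A) = μ A)
    (c : ℤ_[p]) :
    (p : ENNReal) ^ n * μ {y : ℤ_[p] | ∃ z : ℤ_[p], y = c + (p : ℤ_[p]) ^ n * z} = 1 := by
  have : NeZero (p ^ n) := ⟨pow_ne_zero _ (Fact.out : p.Prime).ne_zero⟩
  have hfib (r : ZMod (p ^ n)) : PadicInt.toZModPow n ⁻¹' {r} =
      {y : ℤ_[p] | ∃ z : ℤ_[p], y = (r.val : ℤ_[p]) + (p : ℤ_[p]) ^ n * z} := by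
    rw [PadicInt.coset_eq_preimage_toZModPow, map_natCast, ZMod.natCast_zmod_val]
  have htrans (d : ℤ_[p]) : μ {y : ℤ_[p] | ∃ z : ℤ_[p], y = d + (p : ℤ_[p]) ^ n * z} =
      μ {y : ℤ_[p] | ∃ z : ℤ_[p], y = (p : ℤ_[p]) ^ n * z} := by
    rw [← hinv d _ (PadicInt.measurableSet_coset p n d)]
    simp
  have hsum := sum_measure_preimage_singleton (μ := μ) (f := PadicInt.toZModPow (p := p) n)
    Finset.univ fun r _ => hfib r ▸ PadicInt.measurableSet_coset p n _
  simpa [hfib, htrans, ZMod.card] using hsum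

/-- For the odometer `T(x) = x + 1` on `ℤ_p`, Haar probability measure
`μ`, and `I = c + pⁿ ℤ_p` (`n ≥ 1`): for every `x` and `k ≥ 2`,
`N_I^{(k)}(x) − N_I^{(k−1)}(x) = pⁿ`; consequently
`μ {x : μ(I)·(N_I^{(k)}(x) − N_I^{(k−1)}(x)) ≤ t}` is `0` for `t < 1` and `1` for
`t ≥ 1`, i.e. the limit law of the `k`-th return times is the Dirac mass at `1`. -/
theorem stmt_10 (p : ℕ) [Fact p.Prime] (n : ℕ) (hn : 1 ≤ n)
    [MeasurableSpace ℤ_[p]] [BorelSpace ℤ_[p]]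
    (μ : Measure ℤ_[p]) [IsProbabilityMeasure μ]
    (hinv : ∀ (a : ℤ_[p]) (A : Set ℤ_[p]), MeasurableSet A → μ ((fun x => a + x) ⁻¹' A) = μ A)
    (T : ℤ_[p] → ℤ_[p]) (hT : T = fun x => x + 1) (c : ℤ_[p])
    (I : Set ℤ_[p])
    (hI : I = {y : ℤ_[p] | ∃ z : ℤ_[p], y = c + (p : ℤ_[p]) ^ n * z}) :
    (∀ x : ℤ_[p], ∀ k : ℕ, 2 ≤ k →
      kthEntranceTime T I k x - kthEntranceTime T I (k - 1) x = p ^ n) ∧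
    (∀ k : ℕ, 2 ≤ k → ∀ t : ℝ,
      μ {x : ℤ_[p] | (μ I).toReal *
          ((kthEntranceTime T I k x : ℝ) - (kthEntranceTime T I (k - 1) x : ℝ)) ≤ t} =
        if t < 1 then 0 else 1) := by
  have : NeZero (p ^ n) := ⟨pow_ne_zero _ (Fact.out : p.Prime).ne_zero⟩
  have hvisit (x : ℤ_[p]) (m : ℕ) :
      T^[m] x ∈ I ↔ (m : ZMod (p ^ n)) = PadicInt.toZModPow n c - PadicInt.toZModPow n x := by
    rw [hI, PadicInt.coset_eq_preimage_toZModPow, hT, add_right_iterate, Set.mem_preimage,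
      Set.mem_singleton_iff, eq_sub_iff_add_eq']
    simp
  have hstep (x : ℤ_[p]) (k : ℕ) (hk : 2 ≤ k) :
      kthEntranceTime T I k x = kthEntranceTime T I (k - 1) x + p ^ n := by
    obtain ⟨j, rfl⟩ := Nat.exists_eq_add_of_le' hk
    exact kthEntranceTime_succ_succ (hvisit x) j
  have hμ : (μ I).toReal * (p : ℝ) ^ n = 1 := by
    have := congrArg ENNReal.toReal (PadicInt.measure_coset p n μ hinv c)
    rw [← hI] at this
    simpa [mul_comm] using this
  refine ⟨fun x k hk => by rw [hstep x k hk, Nat.add_sub_cancel_left], fun k hk t => ?_⟩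
  have hone (x : ℤ_[p]) : (μ I).toReal *
      ((kthEntranceTime T I k x : ℝ) - (kthEntranceTime T I (k - 1) x : ℝ)) = 1 := by
    rw [hstep x k hk, Nat.cast_add, add_sub_cancel_left, Nat.cast_pow, hμ]
  simp_rw [hone]
  split_ifs with ht
  · simp [not_le.2 ht]
  · simp [not_lt.1 ht]
end

section
/- Let p be a prime, n ≥ 1, and b an integer with 1 ≤ b ≤ p − 1. Let T : ℤ_p → ℤ_p be the odometer T(x) = x + 1, μ the Haar probability measure on ℤ_p, and I = ⋃_{a=0}^{b−1} (a·p^{n−1} + p^n ℤ_p). Then μ(I) = b/p^n, and the first return time to I takes exactly two values: for x ∈ a·p^{n−1} + p^n ℤ_p with 0 ≤ a ≤ b − 2 one has N_I^{(1)}(x) = p^{n−1}, while for x ∈ (b−1)·p^{n−1} + p^n ℤ_p one has N_I^{(1)}(x) = p^{n−1}·(1 + p − b). -/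
open Function MeasureTheory

/-- The residue class of `c` modulo `pⁿ` in `ℤ_p`. -/
def padicCylinder (p : ℕ) [Fact p.Prime] (n : ℕ) (c : ℤ_[p]) : Set ℤ_[p] :=
  {y | ∃ z : ℤ_[p], y = c + (p : ℤ_[p]) ^ n * z}

section Cylinder

variable {p : ℕ} [Fact p.Prime] {n : ℕ}

theorem mem_padicCylinder_iff {c y : ℤ_[p]} :
    y ∈ padicCylinder p n c ↔ PadicInt.toZModPow n y = PadicInt.toZModPow n c := by
  rw [← sub_eq_zero, ← map_sub, ← RingHom.mem_ker, PadicInt.ker_toZModPow,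
    Ideal.mem_span_singleton]
  simp only [padicCylinder, Set.mem_ofPred_eq, dvd_def, sub_eq_iff_eq_add']

theorem add_natCast_mem_padicCylinder_iff {k l m : ℕ} {x : ℤ_[p]}
    (hx : x ∈ padicCylinder p n (k : ℤ_[p])) :
    x + m ∈ padicCylinder p n (l : ℤ_[p]) ↔ k + m ≡ l [MOD p ^ n] := by
  rw [mem_padicCylinder_iff] at hx ⊢
  rw [map_add, hx, ← map_add, ← Nat.cast_add, map_natCast, map_natCast, ZMod.natCast_eq_natCast_iff]

theorem measurableSet_padicCylinder [MeasurableSpace ℤ_[p]] [BorelSpace ℤ_[p]] (c : ℤ_[p]) :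
    MeasurableSet (padicCylinder p n c) := by
  have h : padicCylinder p n c = Set.range fun z : ℤ_[p] => c + (p : ℤ_[p]) ^ n * z := by
    ext y
    simp [padicCylinder, eq_comm]
  rw [h]
  exact (isCompact_range (by fun_prop)).isClosed.measurableSet

theorem padicCylinder_pairwise_disjoint {s : Set ℕ} (hs : ∀ k ∈ s, k < p ^ n) :
    s.PairwiseDisjoint fun k : ℕ => padicCylinder p n (k : ℤ_[p]) := by
  intro k hk l hl hkl
  refine Set.disjoint_left.2 fun y hyk hyl => hkl ?_
  rw [mem_padicCylinder_iff, map_natCast] at hyk hyl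
  exact Nat.ModEq.eq_of_lt_of_lt ((ZMod.natCast_eq_natCast_iff _ _ _).1 (hyk.symm.trans hyl))
    (hs k hk) (hs l hl)

theorem iUnion_padicCylinder :
    ⋃ k ∈ Finset.range (p ^ n), padicCylinder p n (k : ℤ_[p]) = Set.univ := by
  have : NeZero (p ^ n) := ⟨pow_ne_zero _ (Fact.out : p.Prime).ne_zero⟩
  refine Set.eq_univ_of_forall fun y => Set.mem_iUnion₂.2
    ⟨(PadicInt.toZModPow n y).val, Finset.mem_range.2 (ZMod.val_lt _), ?_⟩
  rw [mem_padicCylinder_iff, map_natCast, ZMod.natCast_zmod_val]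

theorem measure_padicCylinder [MeasurableSpace ℤ_[p]] [BorelSpace ℤ_[p]]
    (μ : Measure ℤ_[p]) [IsProbabilityMeasure μ]
    (hinv : ∀ (a : ℤ_[p]) (A : Set ℤ_[p]), MeasurableSet A → μ ((fun x => a + x) ⁻¹' A) = μ A)
    (c : ℤ_[p]) : μ (padicCylinder p n c) = ((p : ENNReal) ^ n)⁻¹ := by
  have htrans (d : ℤ_[p]) : μ (padicCylinder p n d) = μ (padicCylinder p n 0) := by
    rw [← hinv d _ (measurableSet_padicCylinder d)]
    congr 1
    ext y
    simp [mem_padicCylinder_iff]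
  have hsum := measure_biUnion_finset (μ := μ)
    (padicCylinder_pairwise_disjoint (p := p) (n := n) (s := Finset.range (p ^ n))
      fun k hk => by simpa using hk)
    fun k _ => measurableSet_padicCylinder (k : ℤ_[p])
  rw [iUnion_padicCylinder, measure_univ, Finset.sum_congr rfl fun (k : ℕ) _ => htrans k,
    Finset.sum_const, Finset.card_range, nsmul_eq_mul, Nat.cast_pow, mul_comm] at hsum
  rw [htrans]
  exact ENNReal.eq_inv_of_mul_eq_one_left hsum.symm

end Cylinder

theorem entranceTime_eq_of_isLeast {X : Type*} {T : X → X} {I : Set X} {x : X} {m : ℕ}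
    (h : IsLeast {n : ℕ | 1 ≤ n ∧ T^[n] x ∈ I} m) : entranceTime T I x = m :=
  h.csInf_eq

theorem isLeast_return_of_lt {p b a q : ℕ} (hq : 0 < q) (ha : a + 2 ≤ b) :
    IsLeast {m : ℕ | 1 ≤ m ∧ ∃ l < b, a * q + m ≡ l * q [MOD q * p]} q := by
  refine ⟨⟨hq, a + 1, by omega, by rw [add_mul, one_mul]⟩, ?_⟩
  rintro m ⟨hm, l, -, h⟩
  have hdvd : q ∣ a * q + m :=
    ((h.of_mul_right p).dvd_iff dvd_rfl).2 (dvd_mul_left q l)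
  exact Nat.le_of_dvd hm ((Nat.dvd_add_right (dvd_mul_left q a)).1 hdvd)

theorem isLeast_return_last {p b q : ℕ} (hq : 0 < q) (hb : 1 ≤ b) (hbp : b ≤ p) :
    IsLeast {m : ℕ | 1 ≤ m ∧ ∃ l < b, (b - 1) * q + m ≡ l * q [MOD q * p]}
      (q * (1 + p - b)) := by
  refine ⟨⟨Nat.mul_pos hq (by omega), 0, hb, ?_⟩, ?_⟩
  · have : (b - 1) * q + q * (1 + p - b) = q * p := by
      rw [mul_comm (b - 1), ← mul_add]
      congr 1
      omega
    rw [this, zero_mul]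
    exact Nat.modEq_zero_iff_dvd.2 dvd_rfl
  · rintro m ⟨hm, l, hl, h⟩
    have hdvd : q ∣ (b - 1) * q + m :=
      ((h.of_mul_right p).dvd_iff dvd_rfl).2 (dvd_mul_left q l)
    obtain ⟨j, rfl⟩ := (Nat.dvd_add_right (dvd_mul_left q (b - 1))).1 hdvd
    refine Nat.mul_le_mul_left q (not_lt.1 fun hj => ?_)
    have hj0 : 0 < j := Nat.pos_of_mul_pos_left hm
    rw [mul_comm (b - 1), ← mul_add, mul_comm l] at h
    have := (h.mul_left_cancel' hq.ne').eq_of_lt_of_lt (by omega) (by omega)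
    omega

/-- For the odometer `T(x) = x + 1` on `ℤ_p`, Haar probability measure
`μ`, `n ≥ 1`, `1 ≤ b ≤ p − 1`, and `I = ⋃_{a=0}^{b−1} (a·p^{n−1} + pⁿ ℤ_p)`:
`μ(I) = b/pⁿ`, and the first return time to `I` takes exactly two values:
`N_I^{(1)}(x) = p^{n−1}` on the pieces `a·p^{n−1} + pⁿ ℤ_p` for `0 ≤ a ≤ b − 2`, and
`N_I^{(1)}(x) = p^{n−1}(1 + p − b)` on the piece `(b−1)·p^{n−1} + pⁿ ℤ_p`. -/
theorem stmt_11 (p : ℕ) [Fact p.Prime] (n : ℕ) (hn : 1 ≤ n)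
    (b : ℕ) (hb1 : 1 ≤ b) (hbp : b ≤ p - 1)
    [MeasurableSpace ℤ_[p]] [BorelSpace ℤ_[p]]
    (μ : Measure ℤ_[p]) [IsProbabilityMeasure μ]
    (hinv : ∀ (a : ℤ_[p]) (A : Set ℤ_[p]), MeasurableSet A → μ ((fun x => a + x) ⁻¹' A) = μ A)
    (T : ℤ_[p] → ℤ_[p]) (hT : T = fun x => x + 1)
    (I : Set ℤ_[p])
    (hI : I = ⋃ a ∈ Finset.range b,
      {y : ℤ_[p] | ∃ z : ℤ_[p], y = (a : ℤ_[p]) * (p : ℤ_[p]) ^ (n - 1) + (p : ℤ_[p]) ^ n * z}) :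
    μ I = (b : ENNReal) / ((p : ENNReal) ^ n) ∧
    (∀ a : ℕ, a + 2 ≤ b →
      ∀ x ∈ {y : ℤ_[p] | ∃ z : ℤ_[p], y = (a : ℤ_[p]) * (p : ℤ_[p]) ^ (n - 1) + (p : ℤ_[p]) ^ n * z},
        entranceTime T I x = p ^ (n - 1)) ∧
    (∀ x ∈ {y : ℤ_[p] | ∃ z : ℤ_[p],
        y = ((b : ℤ_[p]) - 1) * (p : ℤ_[p]) ^ (n - 1) + (p : ℤ_[p]) ^ n * z},
      entranceTime T I x = p ^ (n - 1) * (1 + p - b)) := by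
  have hp : p.Prime := Fact.out
  have hq : 0 < p ^ (n - 1) := pow_pos hp.pos _
  have hpow : p ^ n = p ^ (n - 1) * p := (pow_sub_one_mul (by omega) p).symm
  have hIc : I = ⋃ a ∈ Finset.range b, padicCylinder p n ((a * p ^ (n - 1) : ℕ) : ℤ_[p]) := by
    simp only [hI, padicCylinder, Nat.cast_mul, Nat.cast_pow]
  have hiter (m : ℕ) (x : ℤ_[p]) : T^[m] x = x + m := by
    rw [hT, add_right_iterate, nsmul_one]
  have hreturn {a : ℕ} {x : ℤ_[p]}
      (hx : x ∈ padicCylinder p n ((a * p ^ (n - 1) : ℕ) : ℤ_[p])) :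
      {m : ℕ | 1 ≤ m ∧ T^[m] x ∈ I} =
        {m : ℕ | 1 ≤ m ∧ ∃ l < b, a * p ^ (n - 1) + m ≡ l * p ^ (n - 1)
          [MOD p ^ (n - 1) * p]} := by
    ext m
    simp only [hIc, hiter, Set.mem_ofPred_eq, Set.mem_iUnion, Finset.mem_range, exists_prop,
      add_natCast_mem_padicCylinder_iff hx, hpow]
  refine ⟨?_, fun a ha x hx => ?_, fun x hx => ?_⟩
  · rw [hIc, measure_biUnion_finset]
    · simp only [measure_padicCylinder μ hinv, Finset.sum_const, Finset.card_range,
        nsmul_eq_mul, div_eq_mul_inv]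
    · have hinj : Injective fun a : ℕ => a * p ^ (n - 1) :=
        mul_left_injective₀ hq.ne'
      have hdisj := padicCylinder_pairwise_disjoint (p := p) (n := n) (s := Set.Iio (p ^ n))
        fun k hk => hk
      intro k hk l hl hkl
      have hlt {j : ℕ} (hj : j ∈ (Finset.range b : Set ℕ)) : j * p ^ (n - 1) < p ^ n := by
        have hj' : j < b := by simpa using hj
        rw [hpow, mul_comm]
        exact Nat.mul_lt_mul_of_pos_left (by omega) hq
      exact hdisj (hlt hk) (hlt hl) (hinj.ne hkl)
    · exact fun k _ => measurableSet_padicCylinder _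
  · apply entranceTime_eq_of_isLeast
    rw [hreturn (a := a) (by simpa [padicCylinder] using hx)]
    exact isLeast_return_of_lt hq ha
  · apply entranceTime_eq_of_isLeast
    rw [hreturn (a := b - 1) (by simpa [padicCylinder, Nat.cast_sub hb1] using hx)]
    exact isLeast_return_last hq hb1 (by omega)
end

section
/- Let p be a prime and b an integer with 1 ≤ b ≤ p − 1. For n ≥ 1 let T : ℤ_p → ℤ_p be the odometer T(x) = x + 1, μ the Haar probability measure on ℤ_p, and I_n = ⋃_{a=0}^{b−1} (a·p^{n−1} + p^n ℤ_p). Then for every integer m ≥ 0, μ{x ∈ ℤ_p : N_{I_n}^{(1)}(x) ≤ m} = ((b−1)·min(m, p^{n−1}) + min(m, p^{n−1}·(1+p−b)))/p^n. Consequently, setting d_1 = b/p and d_2 = (b/p)·(1+p−b), the distribution functions F_n(t) = μ{x : μ(I_n)·N_{I_n}^{(1)}(x) ≤ t} converge as n → ∞, uniformly in t ≥ 0, to the piecewise linear function F with F(t) = t for 0 ≤ t ≤ d_1, F(t) = (b−1)/p + t/b for d_1 ≤ t ≤ d_2, and F(t) = 1 for t ≥ d_2. -/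
open Function MeasureTheory

lemma PadicInt.exists_eq_natCast_add_pow_mul_iff {p : ℕ} [Fact p.Prime] (n c : ℕ) (y : ℤ_[p]) :
    (∃ z : ℤ_[p], y = c + (p : ℤ_[p]) ^ n * z) ↔ toZModPow n y = (c : ZMod (p ^ n)) := by
  have h : y - c ∈ RingHom.ker (toZModPow (p := p) n) ↔ toZModPow n y = (c : ZMod (p ^ n)) := by
    rw [RingHom.mem_ker, map_sub, map_natCast, sub_eq_zero]
  rw [← h, ker_toZModPow, Ideal.mem_span_singleton]
  exact exists_congr fun z => by rw [sub_eq_iff_eq_add']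

lemma PadicInt.isOpen_preimage_toZModPow {p : ℕ} [Fact p.Prime] (n : ℕ) (c : ZMod (p ^ n)) :
    IsOpen (toZModPow (p := p) n ⁻¹' {c}) := by
  have hp : (0 : ℝ) < p := mod_cast (Fact.out : p.Prime).pos
  refine Metric.isOpen_iff.2 fun x hx => ⟨(p : ℝ) ^ (-n : ℤ), zpow_pos hp _, fun y hy => ?_⟩
  rw [Metric.mem_ball, dist_eq_norm] at hy
  have hker := (norm_le_pow_iff_mem_span_pow _ n).1 hy.le
  rw [← ker_toZModPow, RingHom.mem_ker, map_sub, sub_eq_zero] at hker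
  exact hker.trans hx

section Haar

variable {p : ℕ} [Fact p.Prime] [MeasurableSpace ℤ_[p]] [BorelSpace ℤ_[p]]
  {μ : Measure ℤ_[p]} [IsProbabilityMeasure μ]

/-- A translation-invariant probability measure gives each residue class modulo `p ^ n`
mass `p ^ (-n)`. -/
lemma PadicInt.measure_preimage_toZModPow
    (hinv : ∀ (a : ℤ_[p]) (A : Set ℤ_[p]), MeasurableSet A → μ ((fun x => a + x) ⁻¹' A) = μ A)
    (n : ℕ) (c : ZMod (p ^ n)) :
    μ (toZModPow n ⁻¹' {c}) = ((p : ENNReal) ^ n)⁻¹ := by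
  have hmeas (d : ZMod (p ^ n)) : MeasurableSet (toZModPow (p := p) n ⁻¹' {d}) :=
    (isOpen_preimage_toZModPow n d).measurableSet
  have heq (d : ZMod (p ^ n)) : μ (toZModPow n ⁻¹' {d}) = μ (toZModPow n ⁻¹' {c}) := by
    rw [← hinv ((d - c : ZMod (p ^ n)).val : ℤ_[p]) _ (hmeas d)]
    congr 1
    ext x
    simp [sub_add_eq_add_sub, add_sub_assoc, sub_eq_zero]
  have hsum : ∑ d : ZMod (p ^ n), μ (toZModPow n ⁻¹' {d}) = 1 := by
    rw [sum_measure_preimage_singleton _ fun d _ => hmeas d]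
    simp
  simp only [heq, Finset.sum_const, Finset.card_univ, ZMod.card, nsmul_eq_mul] at hsum
  rw [mul_comm] at hsum
  simpa using ENNReal.eq_inv_of_mul_eq_one_left hsum

/-- The mass of a union of residue classes modulo `p ^ n`. -/
lemma PadicInt.measure_val_toZModPow_mem
    (hinv : ∀ (a : ℤ_[p]) (A : Set ℤ_[p]), MeasurableSet A → μ ((fun x => a + x) ⁻¹' A) = μ A)
    (n : ℕ) (S : Finset ℕ) (hS : ∀ r ∈ S, r < p ^ n) :
    μ {x | (toZModPow n x).val ∈ S} = S.card / (p : ENNReal) ^ n := by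
  classical
  have hset : {x : ℤ_[p] | (toZModPow n x).val ∈ S} =
      toZModPow n ⁻¹' ↑(S.image (Nat.cast : ℕ → ZMod (p ^ n))) := by
    ext x
    simp only [Set.mem_ofPred_eq, Set.mem_preimage, Finset.coe_image, Set.mem_image,
      Finset.mem_coe]
    constructor
    · exact fun h => ⟨_, h, ZMod.natCast_zmod_val _⟩
    · rintro ⟨r, hr, h⟩
      rwa [← h, ZMod.val_natCast_of_lt (hS r hr)]
  have hinj : Set.InjOn (Nat.cast : ℕ → ZMod (p ^ n)) S := fun r hr s hs h => by
    rw [← ZMod.val_natCast_of_lt (hS r hr), h, ZMod.val_natCast_of_lt (hS s hs)]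
  rw [hset, ← sum_measure_preimage_singleton _
    fun d _ => (isOpen_preimage_toZModPow n d).measurableSet]
  simp only [measure_preimage_toZModPow hinv, Finset.sum_const, Finset.card_image_of_injOn hinj,
    nsmul_eq_mul, div_eq_mul_inv]

end Haar

/-- The residues modulo `p * q` from which `{0, q, …, (b - 1) * q}` is entered
within `m` steps. -/
def entranceResidues (p b q m : ℕ) : Finset ℕ :=
  ((Finset.Ico 1 b).biUnion fun a => Finset.Ico (a * q - min m q) (a * q)) ∪
    Finset.Ico (p * q - min m (q * (1 + p - b))) (p * q)

lemma lt_of_mem_entranceResidues {p b q m r : ℕ} (hbp : b < p)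
    (hr : r ∈ entranceResidues p b q m) : r < p * q := by
  simp only [entranceResidues, Finset.mem_union, Finset.mem_biUnion, Finset.mem_Ico] at hr
  rcases hr with ⟨a, ha, hr⟩ | hr
  · nlinarith
  · exact hr.2

lemma card_entranceResidues {p b q m : ℕ} (hb : 1 ≤ b) (hbp : b < p) :
    (entranceResidues p b q m).card = (b - 1) * min m q + min m (q * (1 + p - b)) := by
  obtain ⟨c, rfl⟩ : ∃ c, b = c + 1 := ⟨b - 1, by omega⟩
  obtain ⟨d, rfl⟩ : ∃ d, p = c + d := ⟨p - c, by omega⟩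
  have hd : 1 + (c + d) - (c + 1) = d := by omega
  have hlt (a : ℕ) (ha : 1 ≤ a) : q ≤ a * q := Nat.le_mul_of_pos_left q ha
  rw [entranceResidues, Finset.card_union_of_disjoint, Finset.card_biUnion]
  · congr 1
    · rw [Finset.sum_congr rfl (g := fun _ => min m q)]
      · simp
      · intro a ha
        have := hlt a (Finset.mem_Ico.1 ha).1
        rw [Nat.card_Ico]
        omega
    · rw [Nat.card_Ico, hd]
      have : (c + d) * q = c * q + q * d := by ring
      omega
  · intro a ha a' ha' hne
    rw [onFun, Finset.disjoint_left]
    intro r hr hr'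
    rw [Finset.mem_coe, Finset.mem_Ico] at ha ha'
    rw [Finset.mem_Ico] at hr hr'
    rcases lt_or_gt_of_ne hne with h | h
    · have : (a + 1) * q ≤ a' * q := Nat.mul_le_mul_right q h
      rw [add_mul] at this
      omega
    · have : (a' + 1) * q ≤ a * q := Nat.mul_le_mul_right q h
      rw [add_mul] at this
      omega
  · rw [Finset.disjoint_left]
    intro r hr hr'
    simp only [Finset.mem_biUnion, Finset.mem_Ico] at hr hr'
    obtain ⟨a, ha, hr⟩ := hr
    have h1 : a * q ≤ c * q := Nat.mul_le_mul_right q (by omega)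
    have h2 : (c + d) * q = c * q + q * d := by ring
    rw [hd] at hr'
    omega

/-- An orbit which enters at some time `≥ 1` has entrance time at most `m` iff
it enters at some time in `[1, m]`. -/
lemma entranceTime_le_iff {X : Type*} {T : X → X} {I : Set X} {x : X}
    (hne : ∃ k, 1 ≤ k ∧ T^[k] x ∈ I) (m : ℕ) :
    entranceTime T I x ≤ m ↔ ∃ k, 1 ≤ k ∧ k ≤ m ∧ T^[k] x ∈ I := by
  constructor
  · intro h
    obtain ⟨h1, h2⟩ := Nat.sInf_mem (s := {k | 1 ≤ k ∧ T^[k] x ∈ I}) hne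
    exact ⟨_, h1, h, h2⟩
  · rintro ⟨k, h1, h2, h3⟩
    exact (Nat.sInf_le (show k ∈ {k | 1 ≤ k ∧ T^[k] x ∈ I} from ⟨h1, h3⟩)).trans h2

lemma exists_add_mod_eq_mul_iff {p b q m r : ℕ} (hb : 1 ≤ b) (hbp : b < p) (hr : r < p * q) :
    (∃ k, 1 ≤ k ∧ k ≤ m ∧ ∃ a < b, (r + k) % (p * q) = a * q) ↔
      r ∈ entranceResidues p b q m := by
  obtain ⟨c, rfl⟩ : ∃ c, b = c + 1 := ⟨b - 1, by omega⟩
  obtain ⟨d, rfl⟩ : ∃ d, p = c + d := ⟨p - c, by omega⟩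
  have hd : 1 + (c + d) - (c + 1) = d := by omega
  have hq : 0 < q := Nat.pos_of_ne_zero (by rintro rfl; simp at hr)
  have hN : (c + d) * q = c * q + q * d := by ring
  simp only [entranceResidues, Finset.mem_union, Finset.mem_biUnion, Finset.mem_Ico, hd]
  constructor
  · rintro ⟨k, hk1, hkm, a, ha, hmod⟩
    have hac : a * q ≤ c * q := Nat.mul_le_mul_right q (by omega)
    have hcase : (c + d) * q ≤ r + k ∨ r + k = a * q := by
      by_cases h : r + k < (c + d) * q
      · rw [Nat.mod_eq_of_lt h] at hmod
        exact .inr hmod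
      · exact .inl (by omega)
    by_cases hrc : c * q ≤ r
    · right
      omega
    · left
      have h1 : r / q * q ≤ r := Nat.div_mul_le_self r q
      have h2 : r < (r / q + 1) * q := Nat.lt_mul_of_div_lt (Nat.lt_succ_self _) hq
      have h3 : r / q < c := Nat.div_lt_of_lt_mul (by rw [mul_comm]; omega)
      have h4 : (r / q + 1) * q ≤ c * q := Nat.mul_le_mul_right q h3
      refine ⟨r / q + 1, ⟨Nat.le_add_left 1 _, Nat.succ_lt_succ h3⟩, ?_, h2⟩
      have h5 : (r / q + 1) * q ≤ r + k := by
        rcases hcase with h | h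
        · omega
        · rw [h]
          refine Nat.mul_le_mul_right q ?_
          by_contra hlt
          have : a * q ≤ r / q * q := Nat.mul_le_mul_right q (by omega)
          omega
      rw [add_mul] at h5 ⊢
      omega
  · rintro (⟨a, ha, hr'⟩ | hr')
    · refine ⟨a * q - r, by omega, by omega, a, ha.2, ?_⟩
      have : a * q < (c + d) * q := Nat.mul_lt_mul_of_pos_right (by omega) hq
      rw [Nat.add_sub_cancel' hr'.2.le, Nat.mod_eq_of_lt this]
    · exact ⟨(c + d) * q - r, by omega, by omega, 0, by omega,
        by rw [Nat.add_sub_cancel' hr.le]; simp⟩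

lemma abs_min_floor_div_sub_min_le_s12 {s N K : ℝ} (hs : 0 ≤ s) (hN : 0 < N) :
    |min ((⌊s * N⌋₊ : ℕ) : ℝ) (K * N) / N - min s K| ≤ 1 / N := by
  have h1 := Nat.floor_le (mul_nonneg hs hN.le)
  have h2 := Nat.lt_floor_add_one (s * N)
  have h3 : min s K = min (s * N) (K * N) / N := by
    rw [← min_mul_of_nonneg _ _ hN.le, mul_div_cancel_right₀ _ hN.ne']
  rw [h3, ← sub_div, abs_div, abs_of_pos hN]
  gcongr
  refine (abs_min_sub_min_le_max _ _ _ _).trans (max_le ?_ (by simp))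
  rw [abs_le]
  constructor <;> linarith

/-- For the odometer `T(x) = x + 1` on `ℤ_p`, Haar probability measure
`μ`, `1 ≤ b ≤ p − 1`, and `I_n = ⋃_{a=0}^{b−1} (a·p^{n−1} + pⁿ ℤ_p)` (`n ≥ 1`): for
every `m ≥ 0`,
`μ {x : N_{I_n}^{(1)} x ≤ m} = ((b−1)·min(m, p^{n−1}) + min(m, p^{n−1}(1+p−b)))/pⁿ`.
Consequently, with `d₁ = b/p` and `d₂ = (b/p)(1+p−b)`, the distribution functions
`F_n(t) = μ {x : μ(I_n)·N_{I_n}^{(1)} x ≤ t}` converge, uniformly in `t ≥ 0`, to the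
piecewise linear `F` with `F(t) = t` on `[0,d₁]`, `F(t) = (b−1)/p + t/b` on `[d₁,d₂]`
and `F(t) = 1` for `t ≥ d₂`. -/
theorem stmt_12 (p : ℕ) [Fact p.Prime] (b : ℕ) (hb1 : 1 ≤ b) (hbp : b ≤ p - 1)
    [MeasurableSpace ℤ_[p]] [BorelSpace ℤ_[p]]
    (μ : Measure ℤ_[p]) [IsProbabilityMeasure μ]
    (hinv : ∀ (a : ℤ_[p]) (A : Set ℤ_[p]), MeasurableSet A → μ ((fun x => a + x) ⁻¹' A) = μ A)
    (T : ℤ_[p] → ℤ_[p]) (hT : T = fun x => x + 1)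
    (I : ℕ → Set ℤ_[p])
    (hI : ∀ n : ℕ, I n = ⋃ a ∈ Finset.range b,
      {y : ℤ_[p] | ∃ z : ℤ_[p], y = (a : ℤ_[p]) * (p : ℤ_[p]) ^ (n - 1) + (p : ℤ_[p]) ^ n * z})
    (F : ℝ → ℝ)
    (hF : ∀ t : ℝ, F t =
      if t ≤ (b : ℝ) / p then t
      else if t ≤ ((b : ℝ) / p) * (1 + (p : ℝ) - b) then ((b : ℝ) - 1) / p + t / b
      else 1) :
    (∀ n : ℕ, 1 ≤ n → ∀ m : ℕ,
      μ {x : ℤ_[p] | entranceTime T (I n) x ≤ m} =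
        (((b - 1) * min m (p ^ (n - 1)) + min m (p ^ (n - 1) * (1 + p - b)) : ℕ) : ENNReal) /
          ((p : ENNReal) ^ n)) ∧
    (∀ ε : ℝ, 0 < ε → ∃ N₀ : ℕ, ∀ n : ℕ, N₀ ≤ n → ∀ t : ℝ, 0 ≤ t →
      |(μ {x : ℤ_[p] | (μ (I n)).toReal * (entranceTime T (I n) x : ℝ) ≤ t}).toReal -
        F t| < ε) := by
  have hp : p.Prime := Fact.out
  have hbp' : b < p := by have := hp.pos; omega
  have hpow (n : ℕ) (hn : 1 ≤ n) : p ^ n = p * p ^ (n - 1) := by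
    rw [← pow_succ', Nat.sub_add_cancel hn]
  have hmemI (n : ℕ) (hn : 1 ≤ n) (y : ℤ_[p]) (s : ℕ)
      (hs : PadicInt.toZModPow n y = (s : ZMod (p ^ n))) :
      y ∈ I n ↔ ∃ a < b, s % (p * p ^ (n - 1)) = a * p ^ (n - 1) := by
    simp only [hI, Set.mem_iUnion, Finset.mem_range, Set.mem_ofPred_eq, exists_prop]
    refine exists_congr fun a => and_congr_right fun ha => ?_
    have := PadicInt.exists_eq_natCast_add_pow_mul_iff n (a * p ^ (n - 1)) y
    push_cast at this
    rw [this, hs]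
    norm_cast
    have hlt : a * p ^ (n - 1) < p * p ^ (n - 1) :=
      Nat.mul_lt_mul_of_pos_right (by omega) (pow_pos hp.pos _)
    rw [ZMod.natCast_eq_natCast_iff', hpow n hn, Nat.mod_eq_of_lt hlt]
  have hmemT (n : ℕ) (hn : 1 ≤ n) (x : ℤ_[p]) (k : ℕ) : T^[k] x ∈ I n ↔
      ∃ a < b, ((PadicInt.toZModPow n x).val + k) % (p * p ^ (n - 1)) = a * p ^ (n - 1) := by
    refine hmemI n hn _ _ ?_
    rw [hT, add_right_iterate]
    simp
  have hval (n : ℕ) (hn : 1 ≤ n) (x : ℤ_[p]) :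
      (PadicInt.toZModPow n x).val < p * p ^ (n - 1) := hpow n hn ▸ ZMod.val_lt _
  have htime (n : ℕ) (hn : 1 ≤ n) (m : ℕ) (x : ℤ_[p]) : entranceTime T (I n) x ≤ m ↔
      (PadicInt.toZModPow n x).val ∈ entranceResidues p b (p ^ (n - 1)) m := by
    have hx := hval n hn x
    rw [entranceTime_le_iff, ← exists_add_mod_eq_mul_iff hb1 hbp' hx]
    · simp only [hmemT n hn]
    · refine ⟨p * p ^ (n - 1) - (PadicInt.toZModPow n x).val, by omega, ?_⟩
      rw [hmemT n hn, Nat.add_sub_cancel' hx.le]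
      exact ⟨0, by omega, by simp⟩
  have hdist (n : ℕ) (hn : 1 ≤ n) (m : ℕ) : μ {x : ℤ_[p] | entranceTime T (I n) x ≤ m} =
      (((b - 1) * min m (p ^ (n - 1)) + min m (p ^ (n - 1) * (1 + p - b)) : ℕ) : ENNReal) /
        ((p : ENNReal) ^ n) := by
    simp only [htime n hn]
    rw [PadicInt.measure_val_toZModPow_mem hinv, card_entranceResidues hb1 hbp']
    exact fun r hr => hpow n hn ▸ lt_of_mem_entranceResidues hbp' hr
  refine ⟨hdist, fun ε hε => ?_⟩
  have hμI (n : ℕ) (hn : 1 ≤ n) : μ (I n) = b / (p : ENNReal) ^ n := by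
    have hset : I n = {x | (PadicInt.toZModPow n x).val ∈
        (Finset.range b).image (· * p ^ (n - 1))} := by
      ext x
      rw [hmemI n hn x _ (ZMod.natCast_zmod_val _).symm, Nat.mod_eq_of_lt (hval n hn x)]
      simp [eq_comm]
    rw [hset, PadicInt.measure_val_toZModPow_mem hinv, Finset.card_image_of_injective,
      Finset.card_range]
    · exact fun r s h => Nat.eq_of_mul_eq_mul_right (pow_pos hp.pos _) h
    · intro r hr
      obtain ⟨a, ha, rfl⟩ := Finset.mem_image.1 hr
      rw [Finset.mem_range] at ha
      rw [hpow n hn]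
      exact Nat.mul_lt_mul_of_pos_right (by omega) (pow_pos hp.pos _)
  have hpR : (0 : ℝ) < p := mod_cast hp.pos
  have hbR : (0 : ℝ) < b := mod_cast hb1
  have hbR1 : (1 : ℝ) ≤ b := mod_cast hb1
  have hbpR : (b : ℝ) < p := mod_cast hbp'
  have hFmin (t : ℝ) : F t = (b - 1) * min (t / b) (1 / p) + min (t / b) ((1 + p - b) / p) := by
    have hle : 1 / (p : ℝ) ≤ (1 + p - b) / p := by gcongr; linarith
    have h1 : t ≤ (b : ℝ) / p ↔ t / b ≤ 1 / p := by
      rw [div_le_iff₀ hbR, one_div_mul_eq_div]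
    have h2 : t ≤ (b : ℝ) / p * (1 + p - b) ↔ t / b ≤ (1 + p - b) / p := by
      rw [div_le_iff₀ hbR, div_mul_comm, mul_comm]
    rw [hF]
    simp only [h1, h2]
    split_ifs with h h'
    · rw [min_eq_left h, min_eq_left (h.trans hle)]
      field_simp
      ring
    · rw [min_eq_right (not_le.1 h).le, min_eq_left h']
      ring
    · rw [min_eq_right (not_le.1 h).le, min_eq_right (not_le.1 h').le]
      field_simp
      ring
  obtain ⟨N, hN⟩ := exists_nat_gt (b / ε)
  refine ⟨N + 1, fun n hn t ht => ?_⟩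
  have hn1 : 1 ≤ n := by omega
  have hP : (0 : ℝ) < (p : ℝ) ^ n := by positivity
  have hPn : (p : ℝ) ^ n = p * (p : ℝ) ^ (n - 1) := mod_cast hpow n hn1
  have hset : {x : ℤ_[p] | (μ (I n)).toReal * (entranceTime T (I n) x : ℝ) ≤ t} =
      {x | entranceTime T (I n) x ≤ ⌊t / b * (p : ℝ) ^ n⌋₊} := by
    ext x
    rw [Set.mem_ofPred_eq, Set.mem_ofPred_eq, Nat.le_floor_iff (by positivity), hμI n hn1]
    simp only [ENNReal.toReal_div, ENNReal.toReal_pow, ENNReal.toReal_natCast]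
    rw [div_mul_eq_mul_div, div_mul_eq_mul_div, div_le_iff₀ hP, le_div_iff₀ hbR, mul_comm (b : ℝ)]
  have hcast : ((1 + p - b : ℕ) : ℝ) = 1 + p - b := by
    rw [Nat.cast_sub (by omega)]
    push_cast
    rfl
  have hone : ((p : ℝ) ^ (n - 1)) = 1 / p * (p : ℝ) ^ n := by rw [hPn]; field_simp
  have hK : (p : ℝ) ^ (n - 1) * (1 + p - b) = (1 + p - b) / p * (p : ℝ) ^ n := by
    rw [hPn]; field_simp
  rw [hset, hdist n hn1, hFmin]
  simp only [ENNReal.toReal_div, ENNReal.toReal_pow, ENNReal.toReal_natCast]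
  push_cast [Nat.cast_sub hb1, hcast]
  rw [hK, hone, add_div, mul_div_assoc, add_sub_add_comm, ← mul_sub]
  have hs : 0 ≤ t / b := by positivity
  have e1 := abs_min_floor_div_sub_min_le_s12 (K := 1 / p) hs hP
  have e2 := abs_min_floor_div_sub_min_le_s12 (K := (1 + p - b) / p) hs hP
  have hlt : (b : ℝ) / (p : ℝ) ^ n < ε := by
    have : (N : ℝ) ≤ (p : ℝ) ^ n := by
      exact_mod_cast (show N ≤ n by omega).trans (Nat.lt_pow_self hp.one_lt).le
    rw [div_lt_comm₀ hP hε]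
    linarith
  refine (abs_add_le _ _).trans_lt (lt_of_le_of_lt ?_ hlt)
  rw [abs_mul, abs_of_nonneg (by linarith : (0 : ℝ) ≤ b - 1)]
  calc _ ≤ ((b : ℝ) - 1) * (1 / (p : ℝ) ^ n) + 1 / (p : ℝ) ^ n := by gcongr
    _ = b / (p : ℝ) ^ n := by ring
end

section
/- Let β ∈ (0,1) be irrational with continued fraction expansion β = [0; d_1, d_2, …], convergents p_k/q_k, and let G be the Gauss map. Suppose (k_i)_{i∈ℕ} is a strictly increasing sequence of positive integers such that q_{k_i−1}/q_{k_i} → w and G^{k_i}(β) → θ as i → ∞, with θ ∈ (0,1). Then q_{k_i} · |β·q_{k_i} − p_{k_i}| → θ/(1 + w·θ) as i → ∞. -/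
open Function

/-- The Gauss map `G(t) = 1/t − ⌊1/t⌋`, the fractional part of `1/t`. -/
noncomputable def gaussMap (t : ℝ) : ℝ := Int.fract (1 / t)

/-- `cfP β k` is the continued fraction numerator `p_{k-1}` of `β`:
`p_{-1} = 1`, `p_0 = 0`, `p_k = d_k p_{k-1} + p_{k-2}` where `d_k = ⌊1/G^{k-1}(β)⌋`
are the partial quotients of `β = [0; d_1, d_2, …]`. -/
noncomputable def cfP (β : ℝ) : ℕ → ℝ
  | 0 => 1
  | 1 => 0
  | (k + 2) => (⌊1 / (gaussMap^[k] β)⌋₊ : ℝ) * cfP β (k + 1) + cfP β k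

/-- `cfQ β k` is the continued fraction denominator `q_{k-1}` of `β`:
`q_{-1} = 0`, `q_0 = 1`, `q_k = d_k q_{k-1} + q_{k-2}` where `d_k = ⌊1/G^{k-1}(β)⌋`
are the partial quotients of `β = [0; d_1, d_2, …]`. -/
noncomputable def cfQ (β : ℝ) : ℕ → ℝ
  | 0 => 0
  | 1 => 1
  | (k + 2) => (⌊1 / (gaussMap^[k] β)⌋₊ : ℝ) * cfQ β (k + 1) + cfQ β k


theorem gaussMap_iterate_mem {β : ℝ} (hirr : Irrational β) (h0 : 0 < β) (h1 : β < 1) (n : ℕ) :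
    Irrational (gaussMap^[n] β) ∧ 0 < gaussMap^[n] β ∧ gaussMap^[n] β < 1 := by
  induction n with
  | zero => exact ⟨hirr, h0, h1⟩
  | succ n ih =>
    rw [Function.iterate_succ_apply']
    have hi : Irrational (gaussMap (gaussMap^[n] β)) := by
      have h := ih.1.inv.sub_intCast ⌊1 / (gaussMap^[n] β)⌋
      rwa [← one_div] at h
    exact ⟨hi, lt_of_le_of_ne (Int.fract_nonneg _) hi.ne_zero.symm, Int.fract_lt_one _⟩

theorem gaussMap_add_floor_mul {t : ℝ} (ht : 0 < t) :
    (gaussMap t + (⌊1 / t⌋₊ : ℝ)) * t = 1 := by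
  rw [gaussMap, natCast_floor_eq_intCast_floor (one_div_pos.2 ht).le, Int.fract_add_floor,
    one_div_mul_cancel ht.ne']

theorem cfQ_nonneg (β : ℝ) (n : ℕ) : 0 ≤ cfQ β n ∧ 0 ≤ cfQ β (n + 1) := by
  induction n with
  | zero => simp [cfQ]
  | succ n ih =>
    refine ⟨ih.2, ?_⟩
    rw [cfQ]
    exact add_nonneg (mul_nonneg (Nat.cast_nonneg _) ih.2) ih.1

theorem cfQ_succ_pos {β : ℝ} (hirr : Irrational β) (h0 : 0 < β) (h1 : β < 1) (n : ℕ) :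
    0 < cfQ β (n + 1) := by
  induction n with
  | zero => simp [cfQ]
  | succ n ih =>
    obtain ⟨-, hpos, hlt⟩ := gaussMap_iterate_mem hirr h0 h1 n
    have hd : 0 < ⌊1 / (gaussMap^[n] β)⌋₊ := Nat.floor_pos.2 (one_le_one_div hpos hlt.le)
    rw [cfQ]
    exact add_pos_of_pos_of_nonneg (mul_pos (Nat.cast_pos.2 hd) ih) (cfQ_nonneg β n).1

theorem mul_cfQ_sub_cfP_succ {β : ℝ} (hirr : Irrational β) (h0 : 0 < β) (h1 : β < 1) (n : ℕ) :
    β * cfQ β (n + 1) - cfP β (n + 1) =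
      -(gaussMap^[n] β) * (β * cfQ β n - cfP β n) := by
  induction n with
  | zero => simp [cfQ, cfP]
  | succ n ih =>
    have h := gaussMap_add_floor_mul (gaussMap_iterate_mem hirr h0 h1 n).2.1
    rw [Function.iterate_succ_apply', cfQ, cfP]
    linear_combination (gaussMap (gaussMap^[n] β) + (⌊1 / (gaussMap^[n] β)⌋₊ : ℝ)) * ih -
      (β * cfQ β n - cfP β n) * h

theorem abs_mul_cfQ_sub_cfP_succ {β : ℝ} (hirr : Irrational β) (h0 : 0 < β) (h1 : β < 1) (n : ℕ) :
    |β * cfQ β (n + 1) - cfP β (n + 1)| = gaussMap^[n] β * |β * cfQ β n - cfP β n| := by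
  rw [mul_cfQ_sub_cfP_succ hirr h0 h1, abs_mul, abs_neg,
    abs_of_pos (gaussMap_iterate_mem hirr h0 h1 n).2.1]

theorem abs_mul_cfQ_sub_cfP_mul_add {β : ℝ} (hirr : Irrational β) (h0 : 0 < β) (h1 : β < 1)
    (n : ℕ) :
    |β * cfQ β n - cfP β n| * (cfQ β (n + 1) + gaussMap^[n] β * cfQ β n) = 1 := by
  induction n with
  | zero => simp [cfQ, cfP]
  | succ n ih =>
    have h := gaussMap_add_floor_mul (gaussMap_iterate_mem hirr h0 h1 n).2.1
    rw [abs_mul_cfQ_sub_cfP_succ hirr h0 h1, Function.iterate_succ_apply', cfQ]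
    linear_combination ih + |β * cfQ β n - cfP β n| * cfQ β (n + 1) * h

theorem cfQ_mul_abs_mul_cfQ_sub_cfP {β : ℝ} (hirr : Irrational β) (h0 : 0 < β) (h1 : β < 1)
    (n : ℕ) :
    cfQ β (n + 1) * |β * cfQ β (n + 1) - cfP β (n + 1)| =
      gaussMap^[n] β / (1 + cfQ β n / cfQ β (n + 1) * gaussMap^[n] β) := by
  have hQ := cfQ_succ_pos hirr h0 h1 n
  have ht := (gaussMap_iterate_mem hirr h0 h1 n).2.1
  have hden : 0 < 1 + cfQ β n / cfQ β (n + 1) * gaussMap^[n] β :=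
    add_pos_of_pos_of_nonneg one_pos
      (mul_nonneg (div_nonneg (cfQ_nonneg β n).1 hQ.le) ht.le)
  have h := abs_mul_cfQ_sub_cfP_mul_add hirr h0 h1 n
  rw [eq_div_iff hden.ne', abs_mul_cfQ_sub_cfP_succ hirr h0 h1]
  have hq : cfQ β (n + 1) * (cfQ β n / cfQ β (n + 1)) = cfQ β n := mul_div_cancel₀ _ hQ.ne'
  linear_combination gaussMap^[n] β * h +
    gaussMap^[n] β ^ 2 * |β * cfQ β n - cfP β n| * hq

/-- For irrational `β ∈ (0,1)` with convergents `p_k/q_k`, Gauss map `G`,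
and a strictly increasing sequence `(k_i)` of positive integers with
`q_{k_i−1}/q_{k_i} → w` and `G^{k_i}(β) → θ ∈ (0,1)`, one has
`q_{k_i}·|β·q_{k_i} − p_{k_i}| → θ/(1 + w·θ)`. -/
theorem stmt_15 (β : ℝ) (hirr : Irrational β) (h0 : 0 < β) (h1 : β < 1)
    (k : ℕ → ℕ) (hk : StrictMono k) (hk1 : ∀ i, 1 ≤ k i)
    (w θ : ℝ) (hθ0 : 0 < θ) (hθ1 : θ < 1)
    (hw : Filter.Tendsto (fun i => cfQ β (k i) / cfQ β (k i + 1)) Filter.atTop (nhds w))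
    (hθ : Filter.Tendsto (fun i => gaussMap^[k i] β) Filter.atTop (nhds θ)) :
    Filter.Tendsto
      (fun i => cfQ β (k i + 1) * |β * cfQ β (k i + 1) - cfP β (k i + 1)|)
      Filter.atTop (nhds (θ / (1 + w * θ))) := by
  have hw0 : 0 ≤ w := ge_of_tendsto' hw fun i =>
    div_nonneg (cfQ_nonneg β (k i)).1 (cfQ_nonneg β (k i)).2
  simp only [cfQ_mul_abs_mul_cfQ_sub_cfP hirr h0 h1]
  exact hθ.div ((hw.mul hθ).const_add 1) (by positivity)
end
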